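/- arXiv:2005.11095 — 4 statements merged into one kernel-verified Lean document; each statement's English description precedes it below -/
import Mathlib

section
/- If σ is an automorphism of ℤ² whose matrix (an element of GL₂(ℤ)) has exactly two nonzero entries — i.e., σ is one of the eight matrices with entries ±1 placed either both on the diagonal or both on the antidiagonal — then there exists a subset A of ℤ² such that (A, σ(A)) is a co-minimal pair in ℤ². -/
open scoped Pointwise

/-- Nonempty subsets `A`, `B` of an abelian group `G` form a *co-minimal pair* if
`A + B = G`, no nonempty proper subset of `A` is an additive complement of `B`,
and no nonempty proper subset of `B` is an additive complement of `A`. -/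
def IsCoMinimalPair {G : Type*} [AddCommGroup G] (A B : Set G) : Prop :=
  A.Nonempty ∧ B.Nonempty ∧ A + B = Set.univ ∧
    (∀ A' : Set G, A'.Nonempty → A' ⊂ A → A' + B ≠ Set.univ) ∧
    (∀ B' : Set G, B'.Nonempty → B' ⊂ B → A + B' ≠ Set.univ)

/-- A pair `(A, f(A))` covering the group is co-minimal as soon as every element of `A` is forced,
in the first as well as in the second position, by some element of the group. -/
lemma IsCoMinimalPair.image_of_forced {G : Type*} [AddCommGroup G] {A : Set G} {f : G → G}
    (hne : A.Nonempty) (hcover : ∀ g, ∃ x ∈ A, ∃ y ∈ A, x + f y = g)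
    (hleft : ∀ a ∈ A, ∃ w, ∀ x ∈ A, ∀ y ∈ A, x + f y = w → x = a)
    (hright : ∀ a ∈ A, ∃ w, ∀ x ∈ A, ∀ y ∈ A, x + f y = w → y = a) :
    IsCoMinimalPair A (f '' A) := by
  refine ⟨hne, hne.image f, ?_, ?_, ?_⟩
  · refine Set.eq_univ_of_forall fun g => ?_
    obtain ⟨x, hx, y, hy, rfl⟩ := hcover g
    exact Set.add_mem_add hx (Set.mem_image_of_mem f hy)
  · intro A' _ hA' h
    obtain ⟨a, ha, ha'⟩ := Set.exists_of_ssubset hA'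
    obtain ⟨w, hw⟩ := hleft a ha
    obtain ⟨x, hx, _, ⟨y, hy, rfl⟩, hxy⟩ := Set.mem_add.1 (h ▸ Set.mem_univ w)
    exact ha' (hw x (hA'.subset hx) y hy hxy ▸ hx)
  · intro B' _ hB' h
    obtain ⟨_, ⟨a, ha, rfl⟩, ha'⟩ := Set.exists_of_ssubset hB'
    obtain ⟨w, hw⟩ := hright a ha
    obtain ⟨x, hx, b, hb, hxy⟩ := Set.mem_add.1 (h ▸ Set.mem_univ w)
    obtain ⟨y, hy, rfl⟩ := hB'.subset hb
    exact ha' (hw x hx y hy hxy ▸ hb)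

/-- The integers all of whose digits in base `-3` are `0` or `1`. -/
inductive IsNegaternaryBinary : ℤ → Prop
  | zero : IsNegaternaryBinary 0
  | mul {n : ℤ} : IsNegaternaryBinary n → IsNegaternaryBinary (-3 * n)
  | mul_add_one {n : ℤ} : IsNegaternaryBinary n → IsNegaternaryBinary (-3 * n + 1)

namespace IsNegaternaryBinary

lemma exists_digit {n : ℤ} (hn : IsNegaternaryBinary n) :
    ∃ m, IsNegaternaryBinary m ∧ (n = -3 * m ∨ n = -3 * m + 1) := by
  cases hn with
  | zero => exact ⟨0, zero, by simp⟩
  | mul h => exact ⟨_, h, Or.inl rfl⟩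
  | mul_add_one h => exact ⟨_, h, Or.inr rfl⟩

lemma exists_add_eq (n : ℤ) :
    ∃ x y, IsNegaternaryBinary x ∧ IsNegaternaryBinary y ∧ x + y = n := by
  induction hk : (4 * n - 1).natAbs using Nat.strong_induction_on generalizing n with
  | _ k ih =>
    subst hk
    by_cases h0 : n = 0
    · exact ⟨0, 0, zero, zero, by simp [h0]⟩
    obtain ⟨m, hm⟩ : ∃ m, n = -3 * m ∨ n = -3 * m + 1 ∨ n = -3 * m + 2 :=
      ⟨-(n / 3), by omega⟩
    obtain ⟨x, y, hx, hy, hxy⟩ := ih (4 * m - 1).natAbs (by omega) m rfl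
    rcases hm with hm | hm | hm
    · exact ⟨_, _, hx.mul, hy.mul, by omega⟩
    · exact ⟨_, _, hx.mul, hy.mul_add_one, by omega⟩
    · exact ⟨_, _, hx.mul_add_one, hy.mul_add_one, by omega⟩

/-- This set of integers contains no nontrivial three-term arithmetic progression. -/
lemma eq_of_add_eq_two_mul {x y c : ℤ} (hx : IsNegaternaryBinary x) (hy : IsNegaternaryBinary y)
    (hc : IsNegaternaryBinary c) (h : x + y = 2 * c) : x = c ∧ y = c := by
  induction hk : x.natAbs + y.natAbs + c.natAbs using Nat.strong_induction_on
    generalizing x y c with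
  | _ k ih =>
    subst hk
    by_cases h0 : x = 0 ∧ y = 0 ∧ c = 0
    · omega
    obtain ⟨x', hx', hxx⟩ := hx.exists_digit
    obtain ⟨y', hy', hyy⟩ := hy.exists_digit
    obtain ⟨c', hc', hcc⟩ := hc.exists_digit
    have := ih (x'.natAbs + y'.natAbs + c'.natAbs) (by omega) hx' hy' hc' (by omega) rfl
    omega

end IsNegaternaryBinary

lemma isCoMinimalPair_image_id :
    IsCoMinimalPair {v : Fin 2 → ℤ | ∀ k, IsNegaternaryBinary (v k)}
      ((fun v => v) '' {v : Fin 2 → ℤ | ∀ k, IsNegaternaryBinary (v k)}) := by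
  refine .image_of_forced ⟨0, fun _ => .zero⟩ (fun g => ?_) (fun a ha => ?_) (fun a ha => ?_)
  · choose x y hx hy hxy using fun k => IsNegaternaryBinary.exists_add_eq (g k)
    exact ⟨x, hx, y, hy, funext hxy⟩
  · exact ⟨a + a, fun x hx y hy h => funext fun k =>
      ((hx k).eq_of_add_eq_two_mul (hy k) (ha k) ((congrFun h k).trans (two_mul _).symm)).1⟩
  · exact ⟨a + a, fun x hx y hy h => funext fun k =>
      ((hx k).eq_of_add_eq_two_mul (hy k) (ha k) ((congrFun h k).trans (two_mul _).symm)).2⟩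

/-- The punctured `i`-axis together with the open positive `j`-half-axis in `ℤ²`. -/
def axisHalfAxis (i j : Fin 2) : Set (Fin 2 → ℤ) :=
  {v | v i ≠ 0 ∧ v j = 0 ∨ v i = 0 ∧ 0 < v j}

lemma isCoMinimalPair_axisHalfAxis {i j : Fin 2} (hij : i ≠ j) {e : ℤ} (he : e = 1 ∨ e = -1)
    {f : (Fin 2 → ℤ) → Fin 2 → ℤ} (hfi : ∀ v, f v i = e * v i) (hfj : ∀ v, f v j = -v j) :
    IsCoMinimalPair (axisHalfAxis i j) (f '' axisHalfAxis i j) := by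
  have hvec (x y : ℤ) : ∃ v : Fin 2 → ℤ, v i = x ∧ v j = y :=
    ⟨fun k => if k = i then x else y, by simp [hij.symm]⟩
  have hext (u v : Fin 2 → ℤ) : u = v ↔ u i = v i ∧ u j = v j := by
    refine ⟨by rintro rfl; simp, fun h => funext fun k => ?_⟩
    obtain rfl | rfl : k = i ∨ k = j := by omega
    exacts [h.1, h.2]
  have hsum (u v w : Fin 2 → ℤ) : u + f v = w ↔ u i + e * v i = w i ∧ u j - v j = w j := by
    rw [hext, Pi.add_apply, Pi.add_apply, hfi, hfj, sub_eq_add_neg]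
  simp only [axisHalfAxis]
  refine .image_of_forced ?_ (fun g => ?_) (fun a ha => ?_) (fun a ha => ?_)
  · obtain ⟨v, hv⟩ := hvec 1 0
    exact ⟨v, by simp [hv]⟩
  · obtain ⟨x, y, x', y', hx, hy, hxg, hyg⟩ : ∃ x y x' y' : ℤ, (x ≠ 0 ∧ y = 0 ∨ x = 0 ∧ 0 < y) ∧
        (x' ≠ 0 ∧ y' = 0 ∨ x' = 0 ∧ 0 < y') ∧ x + e * x' = g i ∧ y - y' = g j := by
      rcases lt_trichotomy (g j) 0 with hj | hj | hj
      · by_cases hi : g i = 0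
        · exact ⟨0, 1, 0, 1 - g j, by omega, by omega, by simp [hi], by omega⟩
        · exact ⟨g i, 0, 0, -g j, by omega, by omega, by simp, by omega⟩
      · by_cases hi : g i = 1
        · exact ⟨2, 0, -e, 0, by omega, by omega, by rcases he with rfl | rfl <;> omega, by omega⟩
        · exact ⟨1, 0, e * (g i - 1), 0, by omega, by rcases he with rfl | rfl <;> omega,
            by rcases he with rfl | rfl <;> omega, by omega⟩
      · by_cases hi : g i = 0
        · exact ⟨0, 1 + g j, 0, 1, by omega, by omega, by simp [hi], by omega⟩
        · exact ⟨0, g j, e * g i, 0, by omega, by rcases he with rfl | rfl <;> omega,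
            by rcases he with rfl | rfl <;> omega, by omega⟩
    obtain ⟨u, rfl, rfl⟩ := hvec x y
    obtain ⟨v, rfl, rfl⟩ := hvec x' y'
    exact ⟨u, hx, v, hy, (hsum u v g).2 ⟨hxg, hyg⟩⟩
  · obtain ⟨w, hwi, hwj⟩ := hvec (if a j = 0 then a i else 1) (if a j = 0 then -1 else a j)
    refine ⟨w, fun x hx y hy h => ?_⟩
    rw [hsum] at h
    rw [hext]
    simp only [Set.mem_ofPred_eq] at ha hx hy
    rcases he with rfl | rfl <;> split_ifs at hwi hwj <;> omega
  · obtain ⟨w, hwi, hwj⟩ := hvec (if a j = 0 then e * a i else 1) (if a j = 0 then 1 else -a j)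
    refine ⟨w, fun x hx y hy h => ?_⟩
    rw [hsum] at h
    rw [hext]
    simp only [Set.mem_ofPred_eq] at ha hx hy
    rcases he with rfl | rfl <;> split_ifs at hwi hwj <;> omega

lemma isCoMinimalPair_axis {b c : ℤ} (hc : c = 1 ∨ c = -1)
    {f : (Fin 2 → ℤ) → Fin 2 → ℤ} (hf : ∀ v, f v = ![b * v 1, c * v 0]) :
    IsCoMinimalPair {v : Fin 2 → ℤ | v 1 = 0} (f '' {v : Fin 2 → ℤ | v 1 = 0}) := by
  have hsum (u v w : Fin 2 → ℤ) :
      u + f v = w ↔ u 0 + b * v 1 = w 0 ∧ u 1 + c * v 0 = w 1 := by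
    rw [funext_iff, Fin.forall_fin_two, Pi.add_apply, Pi.add_apply, hf]
    rfl
  refine .image_of_forced ⟨0, rfl⟩ (fun g => ?_) (fun a ha => ?_) (fun a ha => ?_)
  · refine ⟨![g 0, 0], by simp, ![c * g 1, 0], by simp, (hsum _ _ _).2 ?_⟩
    rcases hc with rfl | rfl <;> simp
  · refine ⟨a, fun x hx y hy h => ?_⟩
    rw [hsum] at h
    rw [funext_iff, Fin.forall_fin_two]
    simp only [Set.mem_ofPred_eq] at ha hx hy
    rw [hy] at h
    omega
  · refine ⟨![0, c * a 0], fun x hx y hy h => ?_⟩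
    rw [hsum] at h
    rw [funext_iff, Fin.forall_fin_two]
    simp only [Set.mem_ofPred_eq] at ha hx hy
    rcases hc with rfl | rfl <;> simp at h <;> omega

/-- An element of `GL₂(ℤ)` with exactly two nonzero entries is diagonal or antidiagonal, with
entries `±1`. -/
lemma diagonal_or_antidiagonal_of_card_eq_two (σ : Matrix.GeneralLinearGroup (Fin 2) ℤ)
    (hσ : (Finset.univ.filter fun p : Fin 2 × Fin 2 =>
      (σ : Matrix (Fin 2) (Fin 2) ℤ) p.1 p.2 ≠ 0).card = 2) :
    (∃ a d : ℤ, (a = 1 ∨ a = -1) ∧ (d = 1 ∨ d = -1) ∧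
      (σ : Matrix (Fin 2) (Fin 2) ℤ) = !![a, 0; 0, d]) ∨
    (∃ b c : ℤ, (b = 1 ∨ b = -1) ∧ (c = 1 ∨ c = -1) ∧
      (σ : Matrix (Fin 2) (Fin 2) ℤ) = !![0, b; c, 0]) := by
  have hdet : IsUnit (σ : Matrix (Fin 2) (Fin 2) ℤ).det :=
    (Matrix.isUnit_iff_isUnit_det _).1 σ.isUnit
  generalize (σ : Matrix (Fin 2) (Fin 2) ℤ) = M at hσ hdet ⊢
  rw [Finset.card_filter, Fintype.sum_prod_type] at hσ
  simp only [Fin.sum_univ_two] at hσ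
  have hM := M.eta_fin_two
  generalize M 0 0 = a at hσ hM
  generalize M 0 1 = b at hσ hM
  generalize M 1 0 = c at hσ hM
  generalize M 1 1 = d at hσ hM
  subst hM
  rw [Matrix.det_fin_two_of] at hdet
  by_cases ha : a = 0 <;> by_cases hb : b = 0 <;> by_cases hc : c = 0 <;> by_cases hd : d = 0 <;>
    simp [ha, hb, hc, hd] at hσ hdet
  · exact Or.inr ⟨b, c, Int.isUnit_iff.1 hdet.1, Int.isUnit_iff.1 hdet.2, by rw [ha, hd]⟩
  · exact Or.inl ⟨a, d, Int.isUnit_iff.1 hdet.1, Int.isUnit_iff.1 hdet.2, by rw [hb, hc]⟩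

/-- If `σ ∈ GL₂(ℤ)` has exactly two nonzero entries, then there exists `A ⊆ ℤ²` such that
`(A, σ(A))` is a co-minimal pair in `ℤ²`. -/
theorem exists_coMinimalPair_with_image_GL2 (σ : Matrix.GeneralLinearGroup (Fin 2) ℤ)
    (hσ : (Finset.univ.filter fun p : Fin 2 × Fin 2 =>
      (σ : Matrix (Fin 2) (Fin 2) ℤ) p.1 p.2 ≠ 0).card = 2) :
    ∃ A : Set (Fin 2 → ℤ),
      IsCoMinimalPair A ((fun v => (σ : Matrix (Fin 2) (Fin 2) ℤ).mulVec v) '' A) := by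
  obtain ⟨a, d, ha, hd, hM⟩ | ⟨b, c, -, hc, hM⟩ := diagonal_or_antidiagonal_of_card_eq_two σ hσ
  · rw [hM]
    rcases hd with rfl | rfl
    · rcases ha with rfl | rfl
      · refine ⟨{v | ∀ k, IsNegaternaryBinary (v k)}, ?_⟩
        simpa only [← Matrix.one_fin_two, Matrix.one_mulVec] using isCoMinimalPair_image_id
      · exact ⟨_, isCoMinimalPair_axisHalfAxis (i := 1) (j := 0) (by decide) (Or.inl rfl)
          (fun v => by simp [Matrix.mulVec, Matrix.vecHead, Matrix.vecTail])
          (fun v => by simp [Matrix.mulVec, Matrix.vecHead, Matrix.vecTail])⟩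
    · exact ⟨_, isCoMinimalPair_axisHalfAxis (i := 0) (j := 1) (by decide) ha
        (fun v => by simp [Matrix.mulVec, Matrix.vecHead, Matrix.vecTail])
        (fun v => by simp [Matrix.mulVec, Matrix.vecHead, Matrix.vecTail])⟩
  · rw [hM]
    exact ⟨_, isCoMinimalPair_axis (b := b) hc fun v => by
      simp [Matrix.vecHead, Matrix.vecTail]⟩
end

section
/- For every d ≥ 1, the set of automorphisms σ of ℤ^{2d} (i.e., σ ∈ GL_{2d}(ℤ)) for which there exists a subset A of ℤ^{2d} such that (A, σ(A)) is a co-minimal pair in ℤ^{2d} is infinite. -/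
open scoped Pointwise

theorem isCoMinimalPair_of_isCompl {G : Type*} [AddCommGroup G] {A B : AddSubgroup G}
    (h : IsCompl A B) : IsCoMinimalPair (A : Set G) (B : Set G) := by
  have key : ∀ {a a' b b' : G}, a ∈ A → a' ∈ A → b ∈ B → b' ∈ B → a + b = a' + b' →
      a = a' ∧ b = b' := by
    intro a a' b b' ha ha' hb hb' hab
    have hsub : a - a' = b' - b := by
      rw [sub_eq_sub_iff_add_eq_add, hab, add_comm]
    have hzero : a - a' = 0 := AddSubgroup.disjoint_def.mp h.disjoint (A.sub_mem ha ha')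
      (hsub ▸ B.sub_mem hb' hb)
    exact ⟨sub_eq_zero.mp hzero, (sub_eq_zero.mp (hsub ▸ hzero)).symm⟩
  refine ⟨⟨0, A.zero_mem⟩, ⟨0, B.zero_mem⟩, ?_, ?_, ?_⟩
  · rw [← AddSubgroup.add_normal, h.sup_eq_top, AddSubgroup.coe_top]
  · intro A' _ hA' hsum
    obtain ⟨a, ha, ha'⟩ := Set.exists_of_ssubset hA'
    obtain ⟨x, hx, y, hy, hxy⟩ := hsum.ge (Set.mem_univ a)
    have := key (hA'.subset hx) ha hy B.zero_mem (hxy.trans (add_zero a).symm)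
    exact ha' (this.1 ▸ hx)
  · intro B' _ hB' hsum
    obtain ⟨b, hb, hb'⟩ := Set.exists_of_ssubset hB'
    obtain ⟨x, hx, y, hy, hxy⟩ := hsum.ge (Set.mem_univ b)
    have := key hx A.zero_mem (hB'.subset hy) hb (hxy.trans (zero_add b).symm)
    exact hb' (this.2 ▸ hy)

/-- The subgroup of integer vectors supported on the index set `s`. -/
def supportedOn {ι : Type*} (s : Set ι) : AddSubgroup (ι → ℤ) where
  carrier := {v | ∀ i ∉ s, v i = 0}
  zero_mem' _ _ := rfl
  add_mem' hv hw i hi := by simp [hv i hi, hw i hi]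
  neg_mem' hv i hi := by simp [hv i hi]

theorem isCompl_supportedOn_compl {ι : Type*} (s : Set ι) :
    IsCompl (supportedOn s) (supportedOn sᶜ) := by
  classical
  refine ⟨AddSubgroup.disjoint_def.mpr fun {v} hv hw => ?_, ?_⟩
  · ext i
    by_cases hi : i ∈ s
    · exact hw i (not_not_intro hi)
    · exact hv i hi
  · refine codisjoint_iff_le_sup.mpr fun v _ => ?_
    rw [← Set.indicator_self_add_compl s v]
    exact AddSubgroup.add_mem_sup (fun i hi => Set.indicator_of_notMem hi v)
      (fun i hi => Set.indicator_of_notMem hi v)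

/-- The block matrix with rows `(0, 1)` and `(1, k)`, as an element of the general linear group
indexed through an identification of the index type with two copies of `m`. -/
def blockSwap {m n : Type*} [Fintype m] [DecidableEq m] [Fintype n] [DecidableEq n]
    (e : n ≃ m ⊕ m) (k : ℤ) : Matrix.GeneralLinearGroup n ℤ where
  val := (Matrix.fromBlocks 0 1 1 (.diagonal fun _ => k)).submatrix e e
  inv := (Matrix.fromBlocks (-(.diagonal fun _ => k)) 1 1 0).submatrix e e
  val_inv := by
    simp [Matrix.submatrix_mul_equiv, Matrix.fromBlocks_multiply, Matrix.fromBlocks_one]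
  inv_val := by
    simp [Matrix.submatrix_mul_equiv, Matrix.fromBlocks_multiply, Matrix.fromBlocks_one]

section blockSwap

variable {m n : Type*} [Fintype m] [DecidableEq m] [Fintype n] [DecidableEq n] (e : n ≃ m ⊕ m)

theorem blockSwap_injective [Nonempty m] : Function.Injective (blockSwap e) := by
  intro k l h
  obtain ⟨i⟩ := ‹Nonempty m›
  have := congrArg (fun M => M.val (e.symm (.inr i)) (e.symm (.inr i))) h
  simpa [blockSwap] using this

theorem blockSwap_mulVec (k : ℤ) (v : n → ℤ) (j : n) :
    (blockSwap e k : Matrix n n ℤ).mulVec v j =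
      Sum.elim (fun i => v (e.symm (.inr i)))
        (fun i => v (e.symm (.inl i)) + k * v (e.symm (.inr i))) (e j) := by
  simp only [blockSwap, Matrix.submatrix_mulVec_equiv, Function.comp_apply,
    Matrix.fromBlocks_mulVec]
  cases e j <;> simp

theorem blockSwap_image_supportedOn (k : ℤ) :
    (fun v => (blockSwap e k : Matrix n n ℤ).mulVec v) ''
        (supportedOn {j | (e j).isLeft} : Set (n → ℤ)) =
      supportedOn {j | (e j).isLeft}ᶜ := by
  ext w
  constructor
  · rintro ⟨v, hv, rfl⟩ j hj
    obtain ⟨i, hi⟩ := Sum.isLeft_iff.mp (not_not.mp hj)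
    dsimp only
    rw [blockSwap_mulVec, hi]
    exact hv _ (by simp)
  · intro hw
    refine ⟨fun j => Sum.elim (fun i => w (e.symm (.inr i))) 0 (e j), fun j hj => ?_, ?_⟩
    · cases h : e j <;> simp_all
    · ext j
      dsimp only
      rw [blockSwap_mulVec]
      cases h : e j with
      | inl i => simpa using (hw j (by simp [h])).symm
      | inr i => simp [e.eq_symm_apply.mpr h]

end blockSwap

/-- For every `d ≥ 1`, there are infinitely many automorphisms `σ` of `ℤ^(2d)` for which
some subset `A` of `ℤ^(2d)` makes `(A, σ(A))` a co-minimal pair. -/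
theorem infinite_automorphisms_with_coMinimalPair (d : ℕ) (hd : 1 ≤ d) :
    {σ : Matrix.GeneralLinearGroup (Fin (2 * d)) ℤ |
      ∃ A : Set (Fin (2 * d) → ℤ),
        IsCoMinimalPair A
          ((fun v => (σ : Matrix (Fin (2 * d)) (Fin (2 * d)) ℤ).mulVec v) '' A)}.Infinite := by
  have : Nonempty (Fin d) := ⟨⟨0, hd⟩⟩
  let e : Fin (2 * d) ≃ Fin d ⊕ Fin d := (finCongr (two_mul d)).trans finSumFinEquiv.symm
  refine Set.infinite_of_injective_forall_mem (blockSwap_injective e) fun k =>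
    ⟨supportedOn {j | (e j).isLeft}, ?_⟩
  rw [blockSwap_image_supportedOn]
  exact isCoMinimalPair_of_isCompl (isCompl_supportedOn_compl _)
end

section
/- Let d ≥ 1 and let σ be an automorphism of ℤ^{2d} whose matrix with respect to the standard basis is block upper triangular with 2×2 blocks, each of whose d diagonal 2×2 blocks equals [[0,1],[1,0]] or [[0,−1],[−1,0]]. Then there exists a subset A of ℤ^{2d} contained in a quadrant — i.e., for each coordinate index 1 ≤ i ≤ 2d, either the i-th coordinate of every point of A is positive, or the i-th coordinate of every point of A is negative — such that (A, σ(A)) is a co-minimal pair in ℤ^{2d}. -/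
open scoped Pointwise

open Filter

namespace CoMinimal

variable {G : Type*} [AddCommGroup G]

/-- A finite approximation of the set `A`: the points of `W` are sums `a + σ b`
with `a, b ∈ F` in exactly one way. -/
structure IsStage (σ : AddMonoid.End G) (Q : Set G) (F W : Set G) : Prop where
  finite_left : F.Finite
  finite_right : W.Finite
  subset : F ⊆ Q
  rep : ∀ w ∈ W, ∃ a ∈ F, ∃ b ∈ F, a + σ b = w
  uniq : ∀ a ∈ F, ∀ b ∈ F, ∀ a' ∈ F, ∀ b' ∈ F, a + σ b ∈ W → a + σ b = a' + σ b' →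
    a = a' ∧ b = b'
  symm : σ * σ = 1 → ∀ w ∈ W, σ w ∈ W

/-- Both `x ∈ F` and `σ x ∈ σ F` are used in the representation of a point of `W`. -/
def IsWitnessed (σ : AddMonoid.End G) (F W : Set G) (x : G) : Prop :=
  (∃ z ∈ F, x + σ z ∈ W) ∧ ∃ z ∈ F, z + σ x ∈ W

lemma IsWitnessed.mono {σ : AddMonoid.End G} {F W F' W' : Set G} {x : G}
    (h : IsWitnessed σ F W x) (hF : F ⊆ F') (hW : W ⊆ W') : IsWitnessed σ F' W' x :=
  ⟨h.1.imp fun _ hz => ⟨hF hz.1, hW hz.2⟩, h.2.imp fun _ hz => ⟨hF hz.1, hW hz.2⟩⟩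

/-- The sequence `y` eventually leaves every fibre of every nonzero endomorphism. -/
def IsGeneric (y : ℕ → G) : Prop :=
  ∀ L : AddMonoid.End G, L ≠ 0 → ∀ c, ∀ᶠ T in atTop, L (y T) ≠ c

section Step

variable {σ : AddMonoid.End G} {Q F W : Set G} {y : ℕ → G}

lemma IsStage.exists_witness (hs : IsStage σ Q F W) (hσ : Function.Injective σ)
    (h0 : (1 : AddMonoid.End G) ≠ 0) (hσ0 : σ ≠ 0) (hsub : 1 - σ ≠ 0) (hadd : 1 + σ ≠ 0)
    (hy : IsGeneric y) (hyQ : ∀ᶠ T in atTop, y T ∈ Q) {x : G} (hx : x ∈ F) :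
    ∃ F' W', IsStage σ Q F' W' ∧ F ⊆ F' ∧ W ⊆ W' ∧ IsWitnessed σ F' W' x ∧
      ∀ z ∈ F', z ∈ F ∨ IsWitnessed σ F' W' z := by
  have e1 : ∀ᶠ T in atTop, y T ≠ x := hy 1 h0 x
  have e2 : ∀ᶠ T in atTop, ∀ w ∈ W, y T + σ (y T) ≠ w := by
    rw [eventually_all_finite hs.finite_right]
    exact fun w _ => hy (1 + σ) hadd w
  have e3 : ∀ᶠ T in atTop, ∀ w ∈ W, ∀ f ∈ F, y T ≠ w - σ f := by
    rw [eventually_all_finite hs.finite_right]; intro w _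
    rw [eventually_all_finite hs.finite_left]
    exact fun f _ => hy 1 h0 _
  have e4 : ∀ᶠ T in atTop, ∀ w ∈ W, ∀ f ∈ F, σ (y T) ≠ w - f := by
    rw [eventually_all_finite hs.finite_right]; intro w _
    rw [eventually_all_finite hs.finite_left]
    exact fun f _ => hy σ hσ0 _
  have e5 : ∀ᶠ T in atTop, ∀ f ∈ F, y T - σ (y T) ≠ x - σ f := by
    rw [eventually_all_finite hs.finite_left]
    exact fun f _ => hy (1 - σ) hsub _
  have e6 : ∀ᶠ T in atTop, ∀ f ∈ F, y T - σ (y T) ≠ f - σ x := by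
    rw [eventually_all_finite hs.finite_left]
    exact fun f _ => hy (1 - σ) hsub _
  have e7 : ∀ᶠ T in atTop, ∀ f ∈ F, ∀ f' ∈ F, σ (y T) ≠ f + σ f' - x := by
    rw [eventually_all_finite hs.finite_left]; intro f _
    rw [eventually_all_finite hs.finite_left]
    exact fun f' _ => hy σ hσ0 _
  have e8 : ∀ᶠ T in atTop, ∀ f ∈ F, ∀ f' ∈ F, y T ≠ f + σ f' - σ x := by
    rw [eventually_all_finite hs.finite_left]; intro f _
    rw [eventually_all_finite hs.finite_left]
    exact fun f' _ => hy 1 h0 _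
  obtain ⟨T, hQ, h1, h2, h3, h4, h5, h6, h7, h8⟩ :=
    (hyQ.and (e1.and (e2.and (e3.and (e4.and (e5.and (e6.and (e7.and e8)))))))).exists
  generalize y T = z at *
  have old : ∀ a ∈ insert z F, ∀ b ∈ insert z F, a + σ b ∈ W → a ∈ F ∧ b ∈ F := by
    rintro a (rfl | ha) b (rfl | hb) hw
    · exact absurd rfl (h2 _ hw)
    · exact absurd (by abel) (h3 _ hw b hb)
    · exact absurd (by abel) (h4 _ hw a ha)
    · exact ⟨ha, hb⟩
  have hu : ∀ a ∈ insert z F, ∀ b ∈ insert z F, a + σ b = x + σ z → a = x ∧ b = z := by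
    rintro a (rfl | ha) b (rfl | hb) hw
    · exact absurd (add_right_cancel hw) h1
    · exact absurd (sub_eq_sub_iff_add_eq_add.2 hw) (h5 b hb)
    · exact ⟨add_right_cancel hw, rfl⟩
    · exact absurd (by rw [hw]; abel) (h7 a ha b hb)
  have hv : ∀ a ∈ insert z F, ∀ b ∈ insert z F, a + σ b = z + σ x → a = z ∧ b = x := by
    rintro a (rfl | ha) b (rfl | hb) hw
    · exact absurd (hσ (add_left_cancel hw)) h1
    · exact ⟨rfl, hσ (add_left_cancel hw)⟩
    · exact absurd (sub_eq_sub_iff_add_eq_add.2 hw.symm) (h6 a ha)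
    · exact absurd (by rw [hw]; abel) (h8 a ha b hb)
  have hxz : IsWitnessed σ (insert z F) (insert (x + σ z) (insert (z + σ x) W)) x :=
    ⟨⟨z, by simp, by simp⟩, z, by simp, by simp⟩
  have hzz : IsWitnessed σ (insert z F) (insert (x + σ z) (insert (z + σ x) W)) z :=
    ⟨⟨x, by simp [hx], by simp⟩, x, by simp [hx], by simp⟩
  refine ⟨insert z F, insert (x + σ z) (insert (z + σ x) W), ?_, Set.subset_insert _ _,
    (Set.subset_insert _ _).trans (Set.subset_insert _ _), hxz, ?_⟩
  · refine ⟨hs.finite_left.insert _, (hs.finite_right.insert _).insert _,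
      Set.insert_subset hQ hs.subset, ?_, ?_, ?_⟩
    · rintro w (rfl | rfl | hw)
      · exact ⟨x, by simp [hx], z, by simp, rfl⟩
      · exact ⟨z, by simp, x, by simp [hx], rfl⟩
      · obtain ⟨a, ha, b, hb, h⟩ := hs.rep w hw
        exact ⟨a, .inr ha, b, .inr hb, h⟩
    · rintro a ha b hb a' ha' b' hb' (hw | hw | hw) h
      · obtain ⟨rfl, rfl⟩ := hu a ha b hb hw
        obtain ⟨rfl, rfl⟩ := hu a' ha' b' hb' h.symm
        exact ⟨rfl, rfl⟩
      · obtain ⟨rfl, rfl⟩ := hv a ha b hb hw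
        obtain ⟨rfl, rfl⟩ := hv a' ha' b' hb' h.symm
        exact ⟨rfl, rfl⟩
      · obtain ⟨ha1, hb1⟩ := old a ha b hb hw
        obtain ⟨ha2, hb2⟩ := old a' ha' b' hb' (h ▸ hw)
        exact hs.uniq a ha1 b hb1 a' ha2 b' hb2 hw h
    · intro hinv w hw
      have hinv' : ∀ v, σ (σ v) = v := fun v => DFunLike.congr_fun hinv v
      rcases hw with rfl | rfl | hw
      · right; left; rw [map_add, hinv', add_comm]
      · left; rw [map_add, hinv', add_comm]
      · exact .inr (.inr (hs.symm hinv w hw))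
  · rintro w (rfl | hw)
    · exact .inr hzz
    · exact .inl hw

lemma IsStage.exists_cover (hs : IsStage σ Q F W) (hσ : Function.Injective σ)
    (h0 : (1 : AddMonoid.End G) ≠ 0) (hσ0 : σ ≠ 0) (hadd : 1 + σ ≠ 0)
    (hy : IsGeneric y) (hyQ : ∀ᶠ T in atTop, y T ∈ Q)
    {g : G} (hyσ : ∀ᶠ T in atTop, g - σ (y T) ∈ Q) (hg : ∀ a ∈ F, ∀ b ∈ F, a + σ b ≠ g) :
    ∃ x z, x + σ z = g ∧ IsStage σ Q (insert x (insert z F)) W := by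
  have hσσ : σ * σ ≠ 0 := by
    contrapose! hσ0
    ext v
    exact hσ (by simpa using DFunLike.congr_fun hσ0 v)
  have hσadd : σ + σ * σ ≠ 0 := by
    contrapose! hadd
    ext v
    refine hσ ?_
    have h : σ v + σ (σ v) = 0 := DFunLike.congr_fun hadd v
    change σ (v + σ v) = σ 0
    rw [map_add, h, map_zero]
  have hgW : g ∉ W := fun hw => by
    obtain ⟨a, ha, b, hb, h⟩ := hs.rep g hw
    exact hg a ha b hb h
  have e1 : ∀ᶠ T in atTop, ∀ w ∈ W, σ (y T) + σ (σ (y T)) ≠ g + σ g - w := by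
    rw [eventually_all_finite hs.finite_right]
    exact fun w _ => hy (σ + σ * σ) hσadd _
  have e2 : ∀ᶠ T in atTop, ∀ w ∈ W, ∀ f ∈ F, σ (y T) ≠ g + σ f - w := by
    rw [eventually_all_finite hs.finite_right]; intro w _
    rw [eventually_all_finite hs.finite_left]
    exact fun f _ => hy σ hσ0 _
  have e3 : ∀ᶠ T in atTop, ∀ w ∈ W, y T + σ g - σ (σ (y T)) ≠ w := by
    by_cases hinv : σ * σ = 1
    · have hinv' : ∀ v, σ (σ v) = v := fun v => DFunLike.congr_fun hinv v
      refine Eventually.of_forall fun T w hw h => hgW ?_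
      rw [hinv', add_sub_cancel_left] at h
      rw [← hinv' g, h]
      exact hs.symm hinv w hw
    · rw [eventually_all_finite hs.finite_right]
      intro w _
      refine (hy (1 - σ * σ) (sub_ne_zero.2 (Ne.symm hinv)) (w - σ g)).mono fun T hT h => hT ?_
      rw [← h]
      change y T - σ (σ (y T)) = _
      abel
  have e4 : ∀ᶠ T in atTop, ∀ w ∈ W, y T + σ (y T) ≠ w := by
    rw [eventually_all_finite hs.finite_right]
    exact fun w _ => hy (1 + σ) hadd w
  have e5 : ∀ᶠ T in atTop, ∀ w ∈ W, ∀ f ∈ F, y T ≠ w - σ f := by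
    rw [eventually_all_finite hs.finite_right]; intro w _
    rw [eventually_all_finite hs.finite_left]
    exact fun f _ => hy 1 h0 _
  have e6 : ∀ᶠ T in atTop, ∀ w ∈ W, ∀ f ∈ F, σ (σ (y T)) ≠ f + σ g - w := by
    rw [eventually_all_finite hs.finite_right]; intro w _
    rw [eventually_all_finite hs.finite_left]
    exact fun f _ => hy (σ * σ) hσσ _
  have e7 : ∀ᶠ T in atTop, ∀ w ∈ W, ∀ f ∈ F, σ (y T) ≠ w - f := by
    rw [eventually_all_finite hs.finite_right]; intro w _
    rw [eventually_all_finite hs.finite_left]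
    exact fun f _ => hy σ hσ0 _
  obtain ⟨T, hQ, hQ', h1, h2, h3, h4, h5, h6, h7⟩ :=
    (hyQ.and (hyσ.and (e1.and (e2.and (e3.and (e4.and (e5.and (e6.and e7)))))))).exists
  generalize y T = z at *
  obtain ⟨x, hx⟩ : ∃ x, x = g - σ z := ⟨_, rfl⟩
  have hσx : σ x = σ g - σ (σ z) := by rw [hx, map_sub]
  have old : ∀ a ∈ insert x (insert z F), ∀ b ∈ insert x (insert z F), a + σ b ∈ W →
      a ∈ F ∧ b ∈ F := by
    rintro a (ha | ha | ha) b (hb | hb | hb) hw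
    · refine absurd ?_ (h1 _ hw)
      rw [ha, hb, hσx, hx]; abel
    · rw [ha, hb, hx, sub_add_cancel] at hw
      exact absurd hw hgW
    · refine absurd ?_ (h2 _ hw b hb)
      rw [ha, hx]; abel
    · refine absurd ?_ (h3 _ hw)
      rw [ha, hb, hσx]; abel
    · refine absurd ?_ (h4 _ hw)
      rw [ha, hb]
    · refine absurd ?_ (h5 _ hw b hb)
      rw [ha]; abel
    · refine absurd ?_ (h6 _ hw a ha)
      rw [hb, hσx]; abel
    · refine absurd ?_ (h7 _ hw a ha)
      rw [hb]; abel
    · exact ⟨ha, hb⟩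
  refine ⟨x, z, by rw [hx, sub_add_cancel], (hs.finite_left.insert _).insert _,
    hs.finite_right, Set.insert_subset (hx ▸ hQ') (Set.insert_subset hQ hs.subset), ?_, ?_,
    hs.symm⟩
  · intro w hw
    obtain ⟨a, ha, b, hb, h⟩ := hs.rep w hw
    exact ⟨a, .inr (.inr ha), b, .inr (.inr hb), h⟩
  · intro a ha b hb a' ha' b' hb' hw h
    obtain ⟨ha1, hb1⟩ := old a ha b hb hw
    obtain ⟨ha2, hb2⟩ := old a' ha' b' hb' (h ▸ hw)
    exact hs.uniq a ha1 b hb1 a' ha2 b' hb2 hw h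

lemma IsStage.exists_extension (hs : IsStage σ Q F W) (hw : ∀ x ∈ F, IsWitnessed σ F W x)
    (hσ : Function.Injective σ)
    (h0 : (1 : AddMonoid.End G) ≠ 0) (hσ0 : σ ≠ 0) (hsub : 1 - σ ≠ 0) (hadd : 1 + σ ≠ 0)
    (hy : IsGeneric y) (hyQ : ∀ᶠ T in atTop, y T ∈ Q)
    {g : G} (hyσ : ∀ᶠ T in atTop, g - σ (y T) ∈ Q) :
    ∃ F' W', (IsStage σ Q F' W' ∧ ∀ x ∈ F', IsWitnessed σ F' W' x) ∧ F ⊆ F' ∧ W ⊆ W' ∧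
      ∃ a ∈ F', ∃ b ∈ F', a + σ b = g := by
  by_cases hg : ∃ a ∈ F, ∃ b ∈ F, a + σ b = g
  · exact ⟨F, W, ⟨hs, hw⟩, subset_rfl, subset_rfl, hg⟩
  push Not at hg
  obtain ⟨x, z, hxz, hs1⟩ := hs.exists_cover hσ h0 hσ0 hadd hy hyQ hyσ hg
  obtain ⟨F2, W2, hs2, hF2, hW2, hx2, h2⟩ :=
    hs1.exists_witness hσ h0 hσ0 hsub hadd hy hyQ (x := x) (by simp)
  have hF1 : F ⊆ F2 := (Set.subset_insert z F).trans ((Set.subset_insert x _).trans hF2)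
  obtain ⟨F3, W3, hs3, hF3, hW3, hz3, h3⟩ :=
    hs2.exists_witness hσ h0 hσ0 hsub hadd hy hyQ (x := z) (hF2 (by simp))
  refine ⟨F3, W3, ⟨hs3, fun v hv => ?_⟩, hF1.trans hF3, hW2.trans hW3,
    x, hF3 (hF2 (by simp)), z, hF3 (hF2 (by simp)), hxz⟩
  rcases h3 v hv with hv | hv
  · rcases h2 v hv with (rfl | rfl | hv) | hv
    · exact hx2.mono hF3 hW3
    · exact hz3
    · exact (hw v hv).mono (hF1.trans hF3) (hW2.trans hW3)
    · exact hv.mono hF3 hW3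
  · exact hv

end Step

/-- If a generic sequence eventually lies in `Q` along with every `g - σ (y T)`, then `Q`
contains a set forming a co-minimal pair with its image under `σ`. -/
theorem exists_isCoMinimalPair_image [Countable G] {σ : AddMonoid.End G} {Q : Set G} {y : ℕ → G}
    (hσ : Function.Injective σ)
    (h0 : (1 : AddMonoid.End G) ≠ 0) (hσ0 : σ ≠ 0) (hsub : 1 - σ ≠ 0) (hadd : 1 + σ ≠ 0)
    (hy : IsGeneric y) (hyQ : ∀ᶠ T in atTop, y T ∈ Q)
    (hyσ : ∀ g, ∀ᶠ T in atTop, g - σ (y T) ∈ Q) :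
    ∃ A ⊆ Q, IsCoMinimalPair A (σ '' A) := by
  obtain ⟨e, he⟩ := exists_surjective_nat G
  let S := {p : Set G × Set G // IsStage σ Q p.1 p.2 ∧ ∀ x ∈ p.1, IsWitnessed σ p.1 p.2 x}
  have step : ∀ (s : S) (g : G), ∃ t : S, s.1 ≤ t.1 ∧ ∃ a ∈ t.1.1, ∃ b ∈ t.1.1, a + σ b = g := by
    rintro ⟨⟨F, W⟩, hs, hw⟩ g
    obtain ⟨F', W', h, hF, hW, hg⟩ :=
      hs.exists_extension hw hσ h0 hσ0 hsub hadd hy hyQ (hyσ g)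
    exact ⟨⟨(F', W'), h⟩, ⟨hF, hW⟩, hg⟩
  choose next hle hcov using step
  let s0 : S := ⟨(∅, ∅), ⟨by simp, by simp, by simp, by simp, by simp, by simp⟩, by simp⟩
  let s : ℕ → S := fun n => Nat.rec s0 (fun n t => next t (e n)) n
  have hmono : Monotone fun n => (s n).1 := monotone_nat_of_le_succ fun n => hle (s n) (e n)
  have hF : ∀ {m n}, m ≤ n → (s m).1.1 ⊆ (s n).1.1 := fun h => (hmono h).1
  have hW : ∀ {m n}, m ≤ n → (s m).1.2 ⊆ (s n).1.2 := fun h => (hmono h).2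
  let A : Set G := ⋃ n, (s n).1.1
  have hcover : ∀ g, ∃ a ∈ A, ∃ b ∈ A, a + σ b = g := by
    intro g
    obtain ⟨n, rfl⟩ := he g
    obtain ⟨a, ha, b, hb, h⟩ := hcov (s n) (e n)
    exact ⟨a, Set.mem_iUnion.2 ⟨n + 1, ha⟩, b, Set.mem_iUnion.2 ⟨n + 1, hb⟩, h⟩
  have huniq : ∀ n, ∀ a ∈ A, ∀ b ∈ A, ∀ a' ∈ A, ∀ b' ∈ A, a + σ b ∈ (s n).1.2 →
      a + σ b = a' + σ b' → a = a' ∧ b = b' := by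
    intro n a ha b hb a' ha' b' hb' hw h
    obtain ⟨i, ha⟩ := Set.mem_iUnion.1 ha
    obtain ⟨j, hb⟩ := Set.mem_iUnion.1 hb
    obtain ⟨k, ha'⟩ := Set.mem_iUnion.1 ha'
    obtain ⟨l, hb'⟩ := Set.mem_iUnion.1 hb'
    exact (s (n + i + j + k + l)).2.1.uniq a (hF (by lia) ha) b (hF (by lia) hb)
      a' (hF (by lia) ha') b' (hF (by lia) hb') (hW (by lia) hw) h
  have hne : A.Nonempty := (hcover 0).imp fun _ h => h.1
  refine ⟨A, Set.iUnion_subset fun n => (s n).2.1.subset, hne, hne.image _, ?_, ?_, ?_⟩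
  · refine Set.eq_univ_of_forall fun g => ?_
    obtain ⟨a, ha, b, hb, h⟩ := hcover g
    exact Set.mem_add.2 ⟨a, ha, σ b, Set.mem_image_of_mem _ hb, h⟩
  · intro A' _ hA' huniv
    obtain ⟨x, hx, hxA'⟩ := Set.exists_of_ssubset hA'
    obtain ⟨n, hxn⟩ := Set.mem_iUnion.1 hx
    obtain ⟨z, hz, hw⟩ := ((s n).2.2 x hxn).1
    obtain ⟨a, ha, _, ⟨b, hb, rfl⟩, h⟩ := Set.mem_add.1 (huniv ▸ Set.mem_univ (x + σ z))
    obtain ⟨rfl, -⟩ := huniq n x hx z (Set.mem_iUnion.2 ⟨n, hz⟩) a (hA'.1 ha) b hb hw h.symm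
    exact hxA' ha
  · intro B' _ hB' huniv
    obtain ⟨_, ⟨x, hx, rfl⟩, hxB'⟩ := Set.exists_of_ssubset hB'
    obtain ⟨n, hxn⟩ := Set.mem_iUnion.1 hx
    obtain ⟨z, hz, hw⟩ := ((s n).2.2 x hxn).2
    obtain ⟨a, ha, b, hb, h⟩ := Set.mem_add.1 (huniv ▸ Set.mem_univ (z + σ x))
    obtain ⟨b, hbA, rfl⟩ := hB'.1 hb
    obtain ⟨-, rfl⟩ := huniq n z (Set.mem_iUnion.2 ⟨n, hz⟩) x hx a ha b hbA hw h.symm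
    exact hxB' hb

section Growth

variable {ι : Type*} [Fintype ι]

lemma eventually_sum_mul_pow_ne (c : ι → ℤ) (hc : c ≠ 0) {e : ι → ℕ}
    (he : Function.Injective e) (he0 : ∀ k, e k ≠ 0) (C : ℤ) :
    ∀ᶠ T : ℕ in atTop, ∑ k, c k * (T : ℤ) ^ e k ≠ C := by
  classical
  obtain ⟨k, hk⟩ := Function.ne_iff.1 hc
  let P : Polynomial ℤ := ∑ k, Polynomial.C (c k) * Polynomial.X ^ e k - Polynomial.C C
  have hP : P ≠ 0 := by
    intro h
    apply hk
    have := congrArg (fun p => Polynomial.coeff p (e k)) h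
    simpa [-eq_intCast, P, Polynomial.finsetSum_coeff, Polynomial.coeff_C, he0 k, Polynomial.coeff_X_pow,
      he.eq_iff] using this
  have hfin : {T : ℕ | P.eval (T : ℤ) = 0}.Finite :=
    (Polynomial.finite_setOfPred_isRoot hP).preimage Nat.cast_injective.injOn
  rw [← Nat.cofinite_eq_atTop]
  filter_upwards [hfin.compl_mem_cofinite] with T hT h
  apply hT
  simp [P, Polynomial.eval_finsetSum, h]

lemma eventually_pos_add_sum_mul_pow (c : ι → ℤ) (e : ι → ℕ) (k₀ : ι) (hk₀ : c k₀ = 1)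
    (hlt : ∀ k, k ≠ k₀ → c k = 0 ∨ e k < e k₀) (he0 : e k₀ ≠ 0) (C : ℤ) :
    ∀ᶠ T : ℕ in atTop, 0 < C + ∑ k, c k * (T : ℤ) ^ e k := by
  classical
  obtain ⟨m, hm⟩ := Nat.exists_eq_succ_of_ne_zero he0
  filter_upwards [eventually_ge_atTop (1 + C.natAbs + ∑ k ∈ Finset.univ.erase k₀, (c k).natAbs)]
    with T hT
  have hT' : (1 : ℤ) + |C| + ∑ k ∈ Finset.univ.erase k₀, |c k| ≤ T := by
    have : ((1 + C.natAbs + ∑ k ∈ Finset.univ.erase k₀, (c k).natAbs : ℕ) : ℤ) ≤ T := by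
      exact_mod_cast hT
    simpa using this
  have hK : 0 ≤ ∑ k ∈ Finset.univ.erase k₀, |c k| := Finset.sum_nonneg fun _ _ => abs_nonneg _
  have hT1 : (1 : ℤ) ≤ T := by linarith [abs_nonneg C]
  have hpow : (1 : ℤ) ≤ (T : ℤ) ^ m := one_le_pow₀ hT1
  have hsum : -((∑ k ∈ Finset.univ.erase k₀, |c k|) * (T : ℤ) ^ m) ≤
      ∑ k ∈ Finset.univ.erase k₀, c k * (T : ℤ) ^ e k := by
    rw [Finset.sum_mul, ← Finset.sum_neg_distrib]
    refine Finset.sum_le_sum fun k hk => ?_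
    rcases hlt k (Finset.ne_of_mem_erase hk) with h | h
    · simp [h]
    · have h1 : (T : ℤ) ^ e k ≤ (T : ℤ) ^ m := pow_le_pow_right₀ hT1 (by lia)
      have h2 : (0 : ℤ) ≤ (T : ℤ) ^ e k := by positivity
      nlinarith [neg_abs_le (c k), abs_nonneg (c k),
        mul_le_mul_of_nonneg_left h1 (abs_nonneg (c k)),
        mul_le_mul_of_nonneg_right (neg_abs_le (c k)) h2]
  rw [← Finset.add_sum_erase _ _ (Finset.mem_univ k₀), hk₀, hm, pow_succ]
  nlinarith [neg_abs_le C, abs_nonneg C]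

lemma isGeneric_mul_pow {s : ι → ℤ} (hs : ∀ k, s k ≠ 0) {e : ι → ℕ}
    (he : Function.Injective e) (he0 : ∀ k, e k ≠ 0) :
    IsGeneric fun (T : ℕ) (k : ι) => s k * (T : ℤ) ^ e k := by
  classical
  intro L hL c
  have key : ∀ (v : ι → ℤ) (i : ι), L v i = ∑ k, v k * L (Pi.single k 1) i := by
    intro v i
    conv_lhs => rw [pi_eq_sum_univ' v, map_sum, Finset.sum_apply]
    refine Finset.sum_congr rfl fun k _ => ?_
    rw [map_zsmul]
    simp
  obtain ⟨k, i, hki⟩ : ∃ k i, L (Pi.single k 1) i ≠ 0 := by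
    by_contra! h
    apply hL
    ext v i
    rw [key v i]
    simp [h]
  refine (eventually_sum_mul_pow_ne (fun k => s k * L (Pi.single k 1) i)
    (Function.ne_iff.2 ⟨k, mul_ne_zero (hs k) hki⟩) he he0 (c i)).mono fun T hT h => hT ?_
  rw [← h, key]
  exact Finset.sum_congr rfl fun k _ => by ring

end Growth

end CoMinimal

open CoMinimal in
/-- Let `σ ∈ GL_{2d}(ℤ)` (indexed by `Fin d × Fin 2`) be block upper triangular with
`2 × 2` blocks, whose diagonal blocks are `[[0,1],[1,0]]` or `[[0,−1],[−1,0]]`. Then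
there is a subset `A` of `ℤ^(2d)` contained in a quadrant such that `(A, σ(A))` is a
co-minimal pair. -/
theorem exists_coMinimalPair_in_quadrant (d : ℕ) (hd : 1 ≤ d)
    (σ : Matrix.GeneralLinearGroup (Fin d × Fin 2) ℤ)
    (hupper : ∀ i j : Fin d, ∀ a b : Fin 2, j < i →
      (σ : Matrix (Fin d × Fin 2) (Fin d × Fin 2) ℤ) (i, a) (j, b) = 0)
    (hdiag : ∀ i : Fin d, ∃ ε : ℤ, (ε = 1 ∨ ε = -1) ∧
      (σ : Matrix (Fin d × Fin 2) (Fin d × Fin 2) ℤ) (i, 0) (i, 0) = 0 ∧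
      (σ : Matrix (Fin d × Fin 2) (Fin d × Fin 2) ℤ) (i, 1) (i, 1) = 0 ∧
      (σ : Matrix (Fin d × Fin 2) (Fin d × Fin 2) ℤ) (i, 0) (i, 1) = ε ∧
      (σ : Matrix (Fin d × Fin 2) (Fin d × Fin 2) ℤ) (i, 1) (i, 0) = ε) :
    ∃ A : Set (Fin d × Fin 2 → ℤ),
      (∀ i : Fin d × Fin 2, (∀ v ∈ A, 0 < v i) ∨ (∀ v ∈ A, v i < 0)) ∧
      IsCoMinimalPair A
        ((fun v => (σ : Matrix (Fin d × Fin 2) (Fin d × Fin 2) ℤ).mulVec v) '' A) := by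
  classical
  choose ε hε h00 h11 h01 h10 using hdiag
  set M : Matrix (Fin d × Fin 2) (Fin d × Fin 2) ℤ := (σ : Matrix (Fin d × Fin 2) (Fin d × Fin 2) ℤ)
  let τ : AddMonoid.End (Fin d × Fin 2 → ℤ) := (Matrix.mulVecLin M).toAddMonoidHom
  have hτ : Function.Injective τ := by
    have : IsUnit M := σ.isUnit
    exact Matrix.mulVec_injective_of_isUnit this
  let k : Fin d × Fin 2 := (⟨0, hd⟩, 0)
  have hk1 : (1 : AddMonoid.End (Fin d × Fin 2 → ℤ)) (Pi.single k 1) k = 1 := by simp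
  have hkτ : τ (Pi.single k 1) k = 0 := by
    change M.mulVec (Pi.single k 1) k = 0
    simp [k, h00]
  let s : Fin d × Fin 2 → ℤ := fun p => if p.2 = 0 then 1 else - ε p.1
  have hsq : ∀ p, s p = 1 ∨ s p = -1 := by
    intro p
    rcases hε p.1 with h | h <;> by_cases h2 : p.2 = 0 <;> simp [s, h, h2]
  have hs0 : ∀ p, s p ≠ 0 := fun p => by rcases hsq p with h | h <;> simp [h]
  have hss : ∀ p, s p * s p = 1 := fun p => by rcases hsq p with h | h <;> simp [h]
  let e : Fin d × Fin 2 → ℕ := fun p => 2 * (d - p.1) + p.2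
  have he : Function.Injective e := by
    rintro ⟨i, a⟩ ⟨j, b⟩ h
    simp only [e] at h
    ext <;> simp only <;> lia
  have he0 : ∀ p, e p ≠ 0 := fun p => by simp only [e]; lia
  let y : ℕ → Fin d × Fin 2 → ℤ := fun T p => s p * (T : ℤ) ^ e p
  obtain ⟨A, hAQ, hA⟩ := exists_isCoMinimalPair_image (σ := τ) (y := y)
    (Q := {v | ∀ p, 0 < s p * v p}) hτ
    (fun h => by
      rw [h] at hk1
      exact absurd hk1 (by simp))
    (fun h => by
      have := hτ (a₁ := Pi.single k 1) (a₂ := 0) (by simp [h])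
      simpa using congrFun this k)
    (fun h => by
      have := congrFun (DFunLike.congr_fun h (Pi.single k 1)) k
      change (1 : AddMonoid.End (Fin d × Fin 2 → ℤ)) (Pi.single k 1) k - τ (Pi.single k 1) k = 0 at this
      simp [hkτ] at this)
    (fun h => by
      have := congrFun (DFunLike.congr_fun h (Pi.single k 1)) k
      change (1 : AddMonoid.End (Fin d × Fin 2 → ℤ)) (Pi.single k 1) k + τ (Pi.single k 1) k = 0 at this
      simp [hkτ] at this)
    (isGeneric_mul_pow hs0 he he0)
    (by
      filter_upwards [Filter.eventually_gt_atTop 0] with T hT p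
      simp only [y]
      rw [← mul_assoc, hss]
      positivity)
    (by
      intro g
      change ∀ᶠ T in Filter.atTop, ∀ p, 0 < s p * (g - τ (y T)) p
      rw [Filter.eventually_all]
      rintro ⟨i, a⟩
      have hlead : -(s (i, a) * M (i, a) (i, 1 - a) * s (i, 1 - a)) = 1 := by
        fin_cases a <;> rcases hε i with h | h <;> simp [s, h01, h10, h]
      have hself : M (i, a) (i, a) = 0 := by
        fin_cases a <;> simp [h00, h11]
      refine (eventually_pos_add_sum_mul_pow
        (fun q => -(s (i, a) * M (i, a) q * s q)) e (i, 1 - a) hlead ?_ (he0 _)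
        (s (i, a) * g (i, a))).mono fun T hT => ?_
      · rintro ⟨j, b⟩ hne
        rcases lt_trichotomy j i with h | rfl | h
        · simp [hupper i j a b h]
        · have : b = a := by
            revert hne
            fin_cases a <;> fin_cases b <;> simp
          simp [this, hself]
        · right
          simp only [e]
          lia
      · refine hT.trans_eq ?_
        rw [Pi.sub_apply, mul_sub, sub_eq_add_neg]
        congr 1
        change _ = -(s (i, a) * ∑ q, M (i, a) q * y T q)
        rw [Finset.mul_sum, ← Finset.sum_neg_distrib]
        exact Finset.sum_congr rfl fun q _ => by simp only [y]; ring)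
  refine ⟨A, fun p => ?_, hA⟩
  rcases hsq p with h | h
  · exact .inl fun v hv => by simpa [h] using hAQ hv p
  · exact .inr fun v hv => by simpa [h] using hAQ hv p
end

section
/- Let (P, Q) be a co-minimal pair in (ℤ, +) with Q symmetric, i.e., Q = −Q. Let σ be the automorphism of ℤ² given by σ(x, y) = (y, −x), and let A = P × Q. Then (A, σ(A)) is a co-minimal pair in ℤ². -/
open scoped Pointwise

namespace IsCoMinimalPair

variable {G H : Type*} [AddCommGroup G] [AddCommGroup H]

theorem symm {A B : Set G} (h : IsCoMinimalPair A B) : IsCoMinimalPair B A := by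
  obtain ⟨hA, hB, hAB, hminA, hminB⟩ := h
  refine ⟨hB, hA, by rwa [add_comm], fun B' hne hB' => ?_, fun A' hne hA' => ?_⟩
  · rw [add_comm]
    exact hminB B' hne hB'
  · rw [add_comm]
    exact hminA A' hne hA'

theorem neg {A B : Set G} (h : IsCoMinimalPair A B) : IsCoMinimalPair (-A) (-B) := by
  obtain ⟨hA, hB, hAB, hminA, hminB⟩ := h
  have neg_ssubset {S T : Set G} (hST : S ⊂ -T) : -S ⊂ T :=
    ⟨Set.neg_subset.2 hST.1, fun hTS => hST.2 (Set.neg_subset.2 hTS)⟩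
  refine ⟨hA.neg, hB.neg, by rw [← neg_add, hAB, Set.neg_univ],
    fun A' hne hA' heq => hminA (-A') hne.neg (neg_ssubset hA') ?_,
    fun B' hne hB' heq => hminB (-B') hne.neg (neg_ssubset hB') ?_⟩
  · rw [← neg_neg B, ← neg_add, heq, Set.neg_univ]
  · rw [← neg_neg A, ← neg_add, heq, Set.neg_univ]

/-- Every `a ∈ A` is the only possible left summand of some element of the group. -/
theorem exists_forall_add_eq_imp {A B : Set G} (h : IsCoMinimalPair A B) {a : G} (ha : a ∈ A) :
    ∃ g, ∀ x ∈ A, ∀ b ∈ B, x + b = g → x = a := by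
  by_contra! hcon
  have key : ∀ g, ∃ x ∈ A \ {a}, ∃ b ∈ B, x + b = g := fun g => by
    obtain ⟨x, hx, b, hb, hxb, hxa⟩ := hcon g
    exact ⟨x, ⟨hx, hxa⟩, b, hb, hxb⟩
  obtain ⟨x, hx, -⟩ := key 0
  exact h.2.2.2.1 (A \ {a}) ⟨x, hx⟩ (Set.sdiff_singleton_ssubset.2 ha)
    (Set.eq_univ_of_forall fun g => Set.mem_add.2 (key g))

theorem prod_add_ne_univ {A B : Set G} {C D : Set H} (hAB : IsCoMinimalPair A B)
    (hCD : IsCoMinimalPair C D) {S : Set (G × H)} (hS : S ⊂ A ×ˢ C) :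
    S + B ×ˢ D ≠ Set.univ := by
  intro heq
  obtain ⟨⟨a, c⟩, ⟨ha, hc⟩, hacS⟩ := Set.exists_of_ssubset hS
  obtain ⟨g, hg⟩ := hAB.exists_forall_add_eq_imp ha
  obtain ⟨k, hk⟩ := hCD.exists_forall_add_eq_imp hc
  obtain ⟨⟨x, y⟩, hxy, ⟨b, d⟩, ⟨hb, hd⟩, hsum⟩ := Set.mem_add.1 (heq ▸ Set.mem_univ (g, k))
  obtain ⟨hx, hy⟩ := hS.1 hxy
  obtain ⟨h₁, h₂⟩ := Prod.mk.inj hsum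
  obtain rfl := hg x hx b hb h₁
  obtain rfl := hk y hy d hd h₂
  exact hacS hxy

theorem prod {A B : Set G} {C D : Set H} (hAB : IsCoMinimalPair A B)
    (hCD : IsCoMinimalPair C D) : IsCoMinimalPair (A ×ˢ C) (B ×ˢ D) := by
  refine ⟨hAB.1.prod hCD.1, hAB.2.1.prod hCD.2.1, Set.eq_univ_of_forall fun ⟨g, k⟩ => ?_,
    fun S _ hS => hAB.prod_add_ne_univ hCD hS, fun S _ hS => ?_⟩
  · obtain ⟨a, ha, b, hb, rfl⟩ := Set.mem_add.1 (hAB.2.2.1 ▸ Set.mem_univ g)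
    obtain ⟨c, hc, d, hd, rfl⟩ := Set.mem_add.1 (hCD.2.2.1 ▸ Set.mem_univ k)
    exact Set.mem_add.2 ⟨(a, c), ⟨ha, hc⟩, (b, d), ⟨hb, hd⟩, rfl⟩
  · rw [add_comm]
    exact hAB.symm.prod_add_ne_univ hCD.symm hS

end IsCoMinimalPair

theorem image_rotation_prod (P Q : Set ℤ) :
    (fun p : ℤ × ℤ => (p.2, -p.1)) '' (P ×ˢ Q) = Q ×ˢ (-P) := by
  ext ⟨x, y⟩
  constructor
  · rintro ⟨⟨p, q⟩, ⟨hp, hq⟩, h⟩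
    obtain ⟨rfl, rfl⟩ := Prod.mk.inj h
    exact ⟨hq, Set.neg_mem_neg.2 hp⟩
  · rintro ⟨hx, hy⟩
    exact ⟨(-y, x), ⟨hy, hx⟩, by simp⟩

/-- If `(P, Q)` is a co-minimal pair in `ℤ` with `Q` symmetric, and `σ(x, y) = (y, −x)`,
then `(P × Q, σ(P × Q))` is a co-minimal pair in `ℤ²`. -/
theorem coMinimalPair_prod_rotation (P Q : Set ℤ)
    (hPQ : IsCoMinimalPair P Q) (hQsymm : Q = -Q) :
    IsCoMinimalPair (P ×ˢ Q) ((fun p : ℤ × ℤ => (p.2, -p.1)) '' (P ×ˢ Q)) := by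
  have hneg : IsCoMinimalPair (-P) Q := by
    have h := hPQ.neg
    rwa [← hQsymm] at h
  rw [image_rotation_prod]
  exact hPQ.prod hneg.symm
end
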